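/- arXiv:2504.14853 — 2 statements merged into one kernel-verified Lean document; each statement's English description precedes it below -/
import Mathlib

section
/- Let θ > 0 and S_c(θ) = [[0, 1],[−θ, 0]]. Let d : [0,∞) → ℝ² be a solution of d'(s) = S_c(θ)·d(s) with d(0) ≠ 0, and let ζ : [0,∞) → ℝ be continuous with |ζ(s)| ≤ C₀·e^{−c₀s} for some C₀, c₀ > 0. Set y_d(s) = d₁(s) + ζ(s). Let ι > 0, k₀ > 1/(4ι), k₁ > 0, and let (ξ, χ̂₁, φ̂, θ̂) : [0,∞) → ℝ⁴ be a global continuously differentiable solution of the adaptive observer: ξ'(s) = −ι·ξ(s) − y_d(s), χ̂₁'(s) = φ̂(s) + ι·y_d(s) + θ̂(s)·ξ(s) + k₀·(y_d(s) − χ̂₁(s)), φ̂'(s) = −ι·φ̂(s) − ι²·y_d(s), θ̂'(s) = k₁·ξ(s)·(y_d(s) − χ̂₁(s)), with arbitrary initial values in ℝ⁴. Define d̂(s) = (χ̂₁(s), φ̂(s) + ξ(s)·θ̂(s) + ι·χ̂₁(s)). Then there exist M, μ > 0 such that |θ̂(s) − θ| ≤ M·e^{−μs} and ‖d̂(s)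 − d(s)‖ ≤ M·e^{−μs} for all s ≥ 0. -/
/- STATEMENT 14: exponential convergence of the adaptive observer. With θ > 0,
S_c(θ) = [[0,1],[−θ,0]], d' = S_c(θ) d, d(0) ≠ 0, measurement y_d = d₁ + ζ with
|ζ(s)| ≤ C₀ e^{−c₀ s}, and observer gains ι > 0, k₀ > 1/(4ι), k₁ > 0, every global
C¹ solution (ξ, χ̂₁, φ̂, θ̂) of the adaptive observer ODEs satisfies
|θ̂(s) − θ| ≤ M e^{−μs} and ‖d̂(s) − d(s)‖ ≤ M e^{−μs} (Euclidean norm), where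
d̂ = (χ̂₁, φ̂ + ξ θ̂ + ι χ̂₁). -/

open Set Matrix

/-- Gronwall-type decay lemma with exponentially decaying perturbation. -/
theorem aoc_decay (f f' : ℝ → ℝ) (μ K c : ℝ) (hμ : 0 < μ) (hK : 0 < K) (hc : 0 < c)
    (hf : ∀ s, 0 ≤ s → HasDerivAt f (f' s) s) (hf0 : ∀ s, 0 ≤ s → 0 ≤ f s)
    (hle : ∀ s, 0 ≤ s → f' s ≤ -μ * f s + K * Real.exp (-c * s) * (1 + f s)) :
    ∃ M > (0:ℝ), ∃ m > (0:ℝ), ∀ s, 0 ≤ s → f s ≤ M * Real.exp (-m * s) := by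
  obtain ⟨m, hm, hmμ, hmc⟩ : ∃ m : ℝ, 0 < m ∧ m ≤ μ ∧ m < c :=
    ⟨min μ (c/2), lt_min hμ (by linarith), min_le_left _ _,
      lt_of_le_of_lt (min_le_right _ _) (by linarith)⟩
  set B := K * Real.exp (K / c) / (c - m) with hB
  have hcm : 0 < c - m := by linarith
  have hBpos : 0 < B := by positivity
  set U : ℝ → ℝ := fun s => f s * Real.exp (m * s + K / c * Real.exp (-c * s))
    + B * Real.exp ((m - c) * s) with hU
  have hUd : ∀ s, 0 ≤ s → HasDerivAt U
      (f' s * Real.exp (m * s + K / c * Real.exp (-c * s))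
        + f s * (Real.exp (m * s + K / c * Real.exp (-c * s)) *
          (m * 1 + K / c * (Real.exp (-c * s) * (-c * 1))))
        + B * (Real.exp ((m - c) * s) * ((m - c) * 1))) s := by
    intro s hs
    have h1 : HasDerivAt (fun s : ℝ => Real.exp (-c * s)) (Real.exp (-c * s) * (-c * 1)) s :=
      ((hasDerivAt_id s).const_mul (-c)).exp
    have h2 : HasDerivAt (fun s : ℝ => Real.exp (m * s + K / c * Real.exp (-c * s)))
      (Real.exp (m * s + K / c * Real.exp (-c * s)) *
          (m * 1 + K / c * (Real.exp (-c * s) * (-c * 1)))) s :=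
      (((hasDerivAt_id s).const_mul m).add (h1.const_mul (K / c))).exp
    have h3 : HasDerivAt (fun s : ℝ => Real.exp ((m - c) * s))
      (Real.exp ((m - c) * s) * ((m - c) * 1)) s :=
      ((hasDerivAt_id s).const_mul (m - c)).exp
    exact ((hf s hs).mul h2).add (h3.const_mul B)
  have hanti : AntitoneOn U (Set.Ici 0) := by
    apply antitoneOn_of_deriv_nonpos (convex_Ici 0)
    · intro s hs
      exact (hUd s hs).continuousAt.continuousWithinAt
    · intro s hs
      rw [interior_Ici] at hs
      exact (hUd s (le_of_lt hs)).differentiableAt.differentiableWithinAt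
    · intro s hs
      rw [interior_Ici] at hs
      have hs0 : 0 ≤ s := le_of_lt hs
      rw [(hUd s hs0).deriv]
      set G := Real.exp (m * s + K / c * Real.exp (-c * s)) with hG
      have hGpos : 0 < G := Real.exp_pos _
      set ε := Real.exp (-c * s) with hε
      have hεpos : 0 < ε := Real.exp_pos _
      have hε1 : ε ≤ 1 := by
        rw [hε]; apply Real.exp_le_one_iff.mpr; nlinarith
      have hexp : Real.exp ((m - c) * s) = Real.exp (m * s) * ε := by
        rw [hε, ← Real.exp_add]; congr 1; ring
      have hGle : G ≤ Real.exp (m * s) * Real.exp (K / c) := by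
        rw [hG, ← Real.exp_add]
        apply Real.exp_le_exp.mpr
        have : K / c * ε ≤ K / c * 1 := by gcongr
        linarith
      have hKc : K / c * (ε * (-c * 1)) = -K * ε := by field_simp
      have hBm : B * (Real.exp ((m - c) * s) * ((m - c) * 1))
          = - (K * ε) * (Real.exp (m * s) * Real.exp (K / c)) := by
        rw [hexp, hB]; field_simp; ring
      rw [hKc, hBm]
      have h1 := mul_le_mul_of_nonneg_right (hle s hs0) hGpos.le
      have h2 := mul_le_mul_of_nonneg_left hGle (mul_pos hK hεpos).le
      have h3 : 0 ≤ (μ - m) * f s * G :=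
        mul_nonneg (mul_nonneg (by linarith) (hf0 s hs0)) hGpos.le
      nlinarith
  have hU0 : 0 < |U 0| + 1 := by positivity
  refine ⟨|U 0| + 1, hU0, m, hm, fun s hs => ?_⟩
  have h1 : U s ≤ U 0 := hanti (Set.mem_Ici.mpr le_rfl) (Set.mem_Ici.mpr hs) hs
  have h2 : f s * Real.exp (m * s) ≤ |U 0| + 1 := by
    have h3 : f s * Real.exp (m * s) ≤ f s * Real.exp (m * s + K / c * Real.exp (-c * s)) := by
      apply mul_le_mul_of_nonneg_left _ (hf0 s hs)
      apply Real.exp_le_exp.mpr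
      have : 0 < K / c * Real.exp (-c * s) := by positivity
      linarith
    have h4 : 0 < B * Real.exp ((m - c) * s) := by positivity
    have h5 : U s = f s * Real.exp (m * s + K / c * Real.exp (-c * s))
      + B * Real.exp ((m - c) * s) := rfl
    have := le_abs_self (U 0)
    linarith
  have h6 : Real.exp (m * s) * Real.exp (-m * s) = 1 := by
    rw [← Real.exp_add]; simp
  calc f s = f s * Real.exp (m * s) * Real.exp (-m * s) := by rw [mul_assoc, h6, mul_one]
    _ ≤ _ := mul_le_mul_of_nonneg_right h2 (Real.exp_pos _).le

/-- Linear scalar filter with decaying input. -/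
theorem aoc_filter (p z : ℝ → ℝ) (a b C c : ℝ) (ha : 0 < a) (hC : 0 < C) (hc : 0 < c)
    (hz : ∀ s, 0 ≤ s → |z s| ≤ C * Real.exp (-c * s))
    (hp : ∀ s, 0 ≤ s → HasDerivAt p (-a * p s + b * z s) s) :
    ∃ M > (0:ℝ), ∃ m > (0:ℝ), ∀ s, 0 ≤ s → |p s| ≤ M * Real.exp (-m * s) := by
  obtain ⟨M, hM, m, hm, h⟩ := aoc_decay (fun s => p s * p s)
    (fun s => (-a * p s + b * z s) * p s + p s * (-a * p s + b * z s)) (2 * a) ((|b| + 1) * C) c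
    (by positivity) (by positivity) hc (fun s hs => (hp s hs).mul (hp s hs))
    (fun s _ => mul_self_nonneg _) (by
      intro s hs
      have h1 : p s * b * z s ≤ |p s| * |b| * |z s| := by
        rw [← abs_mul, ← abs_mul]; exact le_abs_self _
      have h2 : |p s| * |b| * |z s| ≤ |p s| * (|b| + 1) * (C * Real.exp (-c * s)) := by
        gcongr
        · linarith
        · exact hz s hs
      have h3 : 2 * |p s| ≤ 1 + p s * p s := by
        nlinarith [sq_nonneg (|p s| - 1), abs_mul_abs_self (p s)]
      have h4 : 0 ≤ (|b| + 1) * (C * Real.exp (-c * s)) := by positivity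
      have h5 := mul_le_mul_of_nonneg_right h3 h4
      nlinarith)
  refine ⟨Real.sqrt M, Real.sqrt_pos.mpr hM, m / 2, by positivity, fun s hs => ?_⟩
  refine abs_le_of_sq_le_sq ?_ (by positivity)
  have h1 := h s hs
  have h2 : Real.exp (-(m/2) * s) ^ 2 = Real.exp (-m * s) := by
    rw [← Real.exp_nat_mul]; congr 1; push_cast; ring
  rw [mul_pow, Real.sq_sqrt hM.le, h2, pow_two]
  exact h1

/-- pointwise perturbation bound -/
theorem aoc_pert (u e q r R : ℝ) (hu : u ^ 2 ≤ e ^ 2 + q ^ 2) (hR : 0 ≤ R)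
    (hr : |r| ≤ R * (1 + |e| + |q|)) : |u * r| ≤ R * (4 * (1 + e ^ 2 + q ^ 2)) := by
  rw [abs_mul]
  calc |u| * |r| ≤ |u| * (R * (1 + |e| + |q|)) := by gcongr
    _ = R * (|u| * (1 + |e| + |q|)) := by ring
    _ ≤ _ := by
      apply mul_le_mul_of_nonneg_left _ hR
      nlinarith [sq_nonneg (|u| - 1), sq_nonneg (|u| - |e|), sq_nonneg (|u| - |q|), sq_abs u,
        sq_abs e, sq_abs q]

theorem aoc_pow_algebra (θ E X A D N k₀ k₁ e q x v : ℝ)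
    (hE0 : 0 < E) (hX : 0 < X) (hk₀ : 0 < k₀) (hk₁ : 0 < k₁)
    (hA : A = 2 * θ) (hθ : 0 < θ) (hD : D = A * k₀ * X + A * X + 2 * k₁ * X ^ 3)
    (hN : 1 + A * k₁ * X ^ 2 + D ^ 2 / (2 * E) ≤ 2 * N * k₀ * k₁)
    (hE : θ * x ^ 2 + v ^ 2 = E) (hx : |x| ≤ X) (hv : |v| ≤ X) :
    -2 * N * k₀ * k₁ * e ^ 2 + A * (-q ^ 2 * x ^ 2 + k₀ * e * q * x + k₁ * x ^ 2 * e ^ 2 - e * q * v)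
      + (-q ^ 2 * v ^ 2 + θ * q ^ 2 * x ^ 2 + 2 * k₁ * x ^ 2 * v * e * q)
      ≤ - e ^ 2 - E / 2 * q ^ 2 := by
  have hx2 : x ^ 2 ≤ X ^ 2 := by rw [← sq_abs x]; gcongr
  have hApos : 0 < A := by rw [hA]; positivity
  have hcoef : |A * k₀ * x - A * v + 2 * k₁ * x ^ 2 * v| ≤ D := by
    have a1 : |A * k₀ * x| ≤ A * k₀ * X := by
      rw [abs_mul, abs_of_pos (mul_pos hApos hk₀)]; gcongr
    have a2 : |A * v| ≤ A * X := by rw [abs_mul, abs_of_pos hApos]; gcongr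
    have a3 : |2 * k₁ * x ^ 2 * v| ≤ 2 * k₁ * X ^ 3 := by
      rw [abs_mul, abs_of_nonneg (by positivity : 0 ≤ 2 * k₁ * x ^ 2)]
      calc 2 * k₁ * x ^ 2 * |v| ≤ 2 * k₁ * X ^ 2 * X := by gcongr
        _ = _ := by ring
    rw [hD]
    exact (abs_add_le _ _).trans (add_le_add ((abs_sub _ _).trans (add_le_add a1 a2)) a3)
  set w := A * k₀ * x - A * v + 2 * k₁ * x ^ 2 * v with hw
  have hw2 : w ^ 2 ≤ D ^ 2 := by rw [← sq_abs w]; gcongr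
  have hyoung : w * e * q ≤ E / 2 * q ^ 2 + D ^ 2 / (2 * E) * e ^ 2 := by
    have h1 : w ^ 2 / (2 * E) * e ^ 2 ≤ D ^ 2 / (2 * E) * e ^ 2 := by gcongr
    have h2 : 0 ≤ (E * q - w * e) ^ 2 / (2 * E) := by positivity
    have h3 : (E * q - w * e) ^ 2 / (2 * E) = E / 2 * q ^ 2 - w * e * q + w ^ 2 / (2 * E) * e ^ 2 := by
      field_simp; ring
    linarith
  have h4 : A * k₁ * e ^ 2 * x ^ 2 ≤ A * k₁ * e ^ 2 * X ^ 2 := by gcongr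
  have h5 := mul_le_mul_of_nonneg_right hN (sq_nonneg e)
  have h6 : -2 * N * k₀ * k₁ * e ^ 2 + A * (-q ^ 2 * x ^ 2 + k₀ * e * q * x + k₁ * x ^ 2 * e ^ 2 - e * q * v)
      + (-q ^ 2 * v ^ 2 + θ * q ^ 2 * x ^ 2 + 2 * k₁ * x ^ 2 * v * e * q)
      = -2 * N * k₀ * k₁ * e ^ 2 + A * k₁ * e ^ 2 * x ^ 2 + w * e * q - E * q ^ 2 := by
    rw [hw, ← hE, hA]; ring
  rw [h6]
  nlinarith

theorem aoc_core (θ E X k₀ k₁ K c : ℝ) (hθ : 0 < θ) (hE0 : 0 < E) (hX : 0 < X)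
    (hk₀ : 0 < k₀) (hk₁ : 0 < k₁) (hK : 0 < K) (hc : 0 < c)
    (x v e q r₁ r₂ : ℝ → ℝ)
    (hxd : ∀ s, 0 ≤ s → HasDerivAt x (v s) s)
    (hvd : ∀ s, 0 ≤ s → HasDerivAt v (-θ * x s) s)
    (hed : ∀ s, 0 ≤ s → HasDerivAt e (-k₀ * e s + q s * x s + r₁ s) s)
    (hqd : ∀ s, 0 ≤ s → HasDerivAt q (-k₁ * x s * e s + r₂ s) s)
    (hE : ∀ s, 0 ≤ s → θ * x s ^ 2 + v s ^ 2 = E)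
    (hx : ∀ s, 0 ≤ s → |x s| ≤ X) (hv : ∀ s, 0 ≤ s → |v s| ≤ X)
    (hr₁ : ∀ s, 0 ≤ s → |r₁ s| ≤ K * Real.exp (-c * s) * (1 + |e s| + |q s|))
    (hr₂ : ∀ s, 0 ≤ s → |r₂ s| ≤ K * Real.exp (-c * s) * (1 + |e s| + |q s|)) :
    ∃ M > (0:ℝ), ∃ m > (0:ℝ), ∀ s, 0 ≤ s → e s ^ 2 + q s ^ 2 ≤ M * Real.exp (-m * s) := by
  obtain ⟨A, hA⟩ : ∃ A : ℝ, A = 2 * θ := ⟨_, rfl⟩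
  set D := A * k₀ * X + A * X + 2 * k₁ * X ^ 3 with hD
  have hApos : 0 < A := by rw [hA]; positivity
  have hDpos : 0 < D := by positivity
  obtain ⟨N, hN0, hN1, hN2, hN3⟩ : ∃ N : ℝ, 0 < N ∧
      1 + A * k₁ * X ^ 2 + D ^ 2 / (2 * E) ≤ 2 * N * k₀ * k₁ ∧
      1 + A * X ≤ N * k₁ ∧ 1 + A * X + X ^ 2 ≤ N := by
    have p1 : 0 < (1 + A * k₁ * X ^ 2 + D ^ 2 / (2 * E)) / (2 * k₀ * k₁) := by positivity
    have p2 : 0 < (1 + A * X) / k₁ := by positivity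
    have p3 : 0 < 1 + A * X + X ^ 2 := by positivity
    refine ⟨(1 + A * k₁ * X ^ 2 + D ^ 2 / (2 * E)) / (2 * k₀ * k₁) + (1 + A * X) / k₁ +
      (1 + A * X + X ^ 2), by linarith, ?_, ?_, by linarith⟩
    · have : 1 + A * k₁ * X ^ 2 + D ^ 2 / (2 * E) =
        (1 + A * k₁ * X ^ 2 + D ^ 2 / (2 * E)) / (2 * k₀ * k₁) * (2 * k₀ * k₁) := by
        rw [div_mul_cancel₀]; positivity
      have h2 : 0 < 2 * k₀ * k₁ := by positivity
      nlinarith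
    · have : 1 + A * X = (1 + A * X) / k₁ * k₁ := by rw [div_mul_cancel₀]; positivity
      nlinarith
  set V : ℝ → ℝ := fun s => N * k₁ * (e s * e s) + N * (q s * q s) - A * (e s * q s * x s)
    - q s * q s * (x s * v s) with hV
  set V' : ℝ → ℝ := fun s =>
    (-2 * N * k₀ * k₁ * e s ^ 2 + A * (-q s ^ 2 * x s ^ 2 + k₀ * e s * q s * x s + k₁ * x s ^ 2 * e s ^ 2 - e s * q s * v s)
      + (-q s ^ 2 * v s ^ 2 + θ * q s ^ 2 * x s ^ 2 + 2 * k₁ * x s ^ 2 * v s * e s * q s))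
      + (2 * N * k₁ * (e s * r₁ s) + 2 * N * (q s * r₂ s) - A * x s * (q s * r₁ s)
        - A * x s * (e s * r₂ s) - 2 * (x s * v s) * (q s * r₂ s)) with hV'
  have hVd : ∀ s, 0 ≤ s → HasDerivAt V (V' s) s := by
    intro s hs
    have he := hed s hs
    have hq := hqd s hs
    have hx := hxd s hs
    have hv := hvd s hs
    have := ((((he.mul he).const_mul (N * k₁)).add ((hq.mul hq).const_mul N)).sub
      (((he.mul hq).mul hx).const_mul A)).sub ((hq.mul hq).mul (hx.mul hv))
    refine this.congr_deriv ?_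
    simp only [hV', Pi.mul_apply]
    ring
  have hxv : ∀ s, 0 ≤ s → |x s * v s| ≤ X ^ 2 := by
    intro s hs
    rw [abs_mul, pow_two]
    exact mul_le_mul (hx s hs) (hv s hs) (abs_nonneg _) hX.le
  have hcross : ∀ s, 0 ≤ s → |A * (e s * q s * x s) + q s * q s * (x s * v s)| ≤
      A * X * (e s ^ 2 + q s ^ 2) + X ^ 2 * q s ^ 2 := by
    intro s hs
    refine (abs_add_le _ _).trans (add_le_add ?_ ?_)
    · rw [abs_mul, abs_of_pos hApos, abs_mul, abs_mul, mul_assoc A]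
      apply mul_le_mul_of_nonneg_left _ hApos.le
      rw [mul_comm]
      apply mul_le_mul (hx s hs) _ (by positivity) hX.le
      nlinarith [sq_nonneg (|e s| - |q s|), sq_abs (e s), sq_abs (q s), sq_nonneg (e s), sq_nonneg (q s)]
    · rw [abs_mul, abs_of_nonneg (mul_self_nonneg (q s)), mul_comm, pow_two (q s)]
      exact mul_le_mul_of_nonneg_right (hxv s hs) (mul_self_nonneg _)
  have hVlow : ∀ s, 0 ≤ s → e s ^ 2 + q s ^ 2 ≤ V s := by
    intro s hs
    have h1 := (abs_le.mp (hcross s hs)).2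
    have h2 := mul_le_mul_of_nonneg_right hN2 (sq_nonneg (e s))
    have h3 := mul_le_mul_of_nonneg_right hN3 (sq_nonneg (q s))
    simp only [hV]
    nlinarith
  set L := N * k₁ + N + A * X + X ^ 2 with hL
  have hLpos : 0 < L := by positivity
  have hVup : ∀ s, 0 ≤ s → V s ≤ L * (e s ^ 2 + q s ^ 2) := by
    intro s hs
    have h1 := (abs_le.mp (hcross s hs)).1
    have h2 : 0 ≤ N * k₁ * q s ^ 2 := by positivity
    have h3 : 0 ≤ N * e s ^ 2 := by positivity
    have h4 : 0 ≤ X ^ 2 * e s ^ 2 := by positivity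
    simp only [hV, hL]
    nlinarith
  obtain ⟨δ, hδ, hδ1, hδ2⟩ : ∃ δ : ℝ, 0 < δ ∧ δ ≤ 1 ∧ δ ≤ E / 2 :=
    ⟨min 1 (E/2), lt_min one_pos (by linarith), min_le_left _ _, min_le_right _ _⟩
  set H := 2 * N * k₁ + 2 * N + A * X + A * X + 2 * X ^ 2 with hH
  have hHpos : 0 < H := by positivity
  obtain ⟨M, hM, m, hm, hfin⟩ := aoc_decay V V' (δ / L) (4 * H * K) c (by positivity) (by positivity) hc
    hVd (fun s hs => le_trans (by positivity) (hVlow s hs)) (by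
      intro s hs
      have hmain := aoc_pow_algebra θ E X A D N k₀ k₁ (e s) (q s) (x s) (v s) hE0 hX hk₀ hk₁
        hA hθ hD hN1 (hE s hs) (hx s hs) (hv s hs)
      set ε := Real.exp (-c * s) with hε
      have hεpos : 0 < ε := Real.exp_pos _
      have hR : 0 ≤ K * ε := by positivity
      have hee : e s ^ 2 ≤ e s ^ 2 + q s ^ 2 := by nlinarith [sq_nonneg (q s)]
      have hqq : q s ^ 2 ≤ e s ^ 2 + q s ^ 2 := by nlinarith [sq_nonneg (e s)]
      have p1 := aoc_pert _ _ _ _ _ hee hR (hr₁ s hs)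
      have p2 := aoc_pert _ _ _ _ _ hqq hR (hr₂ s hs)
      have p3 := aoc_pert _ _ _ _ _ hqq hR (hr₁ s hs)
      have p4 := aoc_pert _ _ _ _ _ hee hR (hr₂ s hs)
      set T := K * ε * (4 * (1 + e s ^ 2 + q s ^ 2)) with hT
      have hTpos : 0 ≤ T := by positivity
      have q1 : 2 * N * k₁ * (e s * r₁ s) ≤ 2 * N * k₁ * T := by
        apply mul_le_mul_of_nonneg_left (le_of_abs_le p1) (by positivity)
      have q2 : 2 * N * (q s * r₂ s) ≤ 2 * N * T := by
        apply mul_le_mul_of_nonneg_left (le_of_abs_le p2) (by positivity)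
      have hAx : |A * x s| ≤ A * X := by
        rw [abs_mul, abs_of_pos hApos]; exact mul_le_mul_of_nonneg_left (hx s hs) hApos.le
      have q3 : |A * x s * (q s * r₁ s)| ≤ A * X * T := by
        rw [abs_mul]; exact mul_le_mul hAx p3 (abs_nonneg _) (by positivity)
      have q4 : |A * x s * (e s * r₂ s)| ≤ A * X * T := by
        rw [abs_mul]; exact mul_le_mul hAx p4 (abs_nonneg _) (by positivity)
      have q5 : |(x s * v s) * (q s * r₂ s)| ≤ X ^ 2 * T := by
        rw [abs_mul]; exact mul_le_mul (hxv s hs) p2 (abs_nonneg _) (by positivity)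
      have q3' := (abs_le.mp q3).1
      have q4' := (abs_le.mp q4).1
      have q5' := (abs_le.mp q5).1
      have hup := hVup s hs
      have hlow := hVlow s hs
      have hTle : T ≤ 4 * K * ε * (1 + V s) := by
        have := mul_le_mul_of_nonneg_left hlow (by positivity : 0 ≤ 4 * K * ε)
        rw [hT]; linarith
      have hHT := mul_le_mul_of_nonneg_left hTle hHpos.le
      have hdV : δ / L * V s ≤ δ * (e s ^ 2 + q s ^ 2) := by
        rw [div_mul_eq_mul_div, div_le_iff₀ hLpos]
        have := mul_le_mul_of_nonneg_left hup hδ.le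
        linarith
      have hd1 := mul_le_mul_of_nonneg_right hδ1 (sq_nonneg (e s))
      have hd2 := mul_le_mul_of_nonneg_right hδ2 (sq_nonneg (q s))
      have hHT' : H * T = 2 * N * k₁ * T + 2 * N * T + A * X * T + A * X * T + 2 * (X ^ 2 * T) := by
        rw [hH]; ring
      simp only [hV']
      linarith)
  exact ⟨M, hM, m, hm, fun s hs => (hVlow s hs).trans (hfin s hs)⟩

theorem aoc_widen {M K m c s : ℝ} (hK : 0 < K) (hMK : M ≤ K) (hcm : c ≤ m) (hs : 0 ≤ s) :
    M * Real.exp (-m * s) ≤ K * Real.exp (-c * s) := by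
  have h : Real.exp (-m * s) ≤ Real.exp (-c * s) := by
    apply Real.exp_le_exp.mpr; nlinarith
  exact mul_le_mul hMK h (Real.exp_pos _).le hK.le

set_option maxHeartbeats 2000000 in
theorem adaptive_observer_exponential_convergence
    (θ : ℝ) (hθ : 0 < θ)
    (d : ℝ → Fin 2 → ℝ)
    (hd : ∀ s ∈ Ici (0:ℝ), HasDerivAt d ((!![0, 1; -θ, 0]).mulVec (d s)) s)
    (hd0 : d 0 ≠ 0)
    (ζ : ℝ → ℝ) (hζcont : Continuous ζ)
    (C₀ c₀ : ℝ) (hC₀ : 0 < C₀) (hc₀ : 0 < c₀)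
    (hζ : ∀ s ∈ Ici (0:ℝ), |ζ s| ≤ C₀ * Real.exp (-c₀ * s))
    (yd : ℝ → ℝ) (hyd : ∀ s : ℝ, yd s = d s 0 + ζ s)
    (ι k₀ k₁ : ℝ) (hι : 0 < ι) (hk₀ : 1 / (4 * ι) < k₀) (hk₁ : 0 < k₁)
    (ξ χ₁ φ θhat : ℝ → ℝ)
    (hC1 : ContDiff ℝ 1 ξ ∧ ContDiff ℝ 1 χ₁ ∧ ContDiff ℝ 1 φ ∧ ContDiff ℝ 1 θhat)
    (hξ : ∀ s ∈ Ici (0:ℝ), HasDerivAt ξ (-ι * ξ s - yd s) s)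
    (hχ₁ : ∀ s ∈ Ici (0:ℝ),
      HasDerivAt χ₁ (φ s + ι * yd s + θhat s * ξ s + k₀ * (yd s - χ₁ s)) s)
    (hφ : ∀ s ∈ Ici (0:ℝ), HasDerivAt φ (-ι * φ s - ι ^ 2 * yd s) s)
    (hθhat : ∀ s ∈ Ici (0:ℝ), HasDerivAt θhat (k₁ * ξ s * (yd s - χ₁ s)) s)
    (dhat : ℝ → Fin 2 → ℝ)
    (hdhat : ∀ s : ℝ, dhat s = ![χ₁ s, φ s + ξ s * θhat s + ι * χ₁ s]) :
    ∃ M > (0:ℝ), ∃ μ > (0:ℝ), ∀ s ∈ Ici (0:ℝ),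
      |θhat s - θ| ≤ M * Real.exp (-μ * s) ∧
      Real.sqrt ((dhat s 0 - d s 0) ^ 2 + (dhat s 1 - d s 1) ^ 2)
        ≤ M * Real.exp (-μ * s) := by
  have hk₀' : 0 < k₀ := lt_trans (by positivity) hk₀
  have hd1 : ∀ s, 0 ≤ s → HasDerivAt (fun s => d s 0) (d s 1) s := by
    intro s hs
    have := (hasDerivAt_pi.mp (hd s hs)) 0
    simpa [Matrix.mulVec, dotProduct, Fin.sum_univ_two] using this
  have hd2 : ∀ s, 0 ≤ s → HasDerivAt (fun s => d s 1) (-θ * d s 0) s := by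
    intro s hs
    have := (hasDerivAt_pi.mp (hd s hs)) 1
    simpa [Matrix.mulVec, dotProduct, Fin.sum_univ_two] using this
  have hζ' : ∀ s, 0 ≤ s → |ζ s| ≤ C₀ * Real.exp (-c₀ * s) := fun s hs => hζ s hs
  obtain ⟨E₀, hE₀⟩ : ∃ E₀ : ℝ, E₀ = θ * (d 0 0 * d 0 0) + d 0 1 * d 0 1 := ⟨_, rfl⟩
  have hE₀pos : 0 < E₀ := by
    rw [hE₀]
    by_contra hcon
    apply hd0
    have a0 := mul_self_nonneg (d 0 0)
    have a1 := mul_self_nonneg (d 0 1)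
    have a2 := mul_nonneg hθ.le a0
    have b1 : d 0 1 * d 0 1 = 0 := by linarith
    have b0 : θ * (d 0 0 * d 0 0) = 0 := by linarith
    have c1 : d 0 1 = 0 := mul_self_eq_zero.mp b1
    have c0 : d 0 0 = 0 := mul_self_eq_zero.mp ((mul_eq_zero.mp b0).resolve_left hθ.ne')
    ext i
    fin_cases i
    · simpa using c0
    · simpa using c1
  have hEconst : ∀ s, 0 ≤ s → θ * (d s 0 * d s 0) + d s 1 * d s 1 = E₀ := by
    have hder : ∀ s, 0 ≤ s →
        HasDerivAt (fun s => θ * (d s 0 * d s 0) + d s 1 * d s 1) 0 s := by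
      intro s hs
      have h := (((hd1 s hs).mul (hd1 s hs)).const_mul θ).add ((hd2 s hs).mul (hd2 s hs))
      refine h.congr_deriv ?_
      ring
    intro s hs
    rw [hE₀]
    exact constant_of_has_deriv_right_zero (a := 0) (b := s)
      (fun t ht => (hder t ht.1).continuousAt.continuousWithinAt)
      (fun t ht => (hder t ht.1).hasDerivWithinAt) s ⟨hs, le_rfl⟩
  obtain ⟨β, hβ⟩ : ∃ β : ℝ, β = (ι ^ 2 + θ)⁻¹ := ⟨_, rfl⟩
  have hden : 0 < ι ^ 2 + θ := by positivity
  have hβpos : 0 < β := by rw [hβ]; positivity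
  have hβ1 : β * (ι ^ 2 + θ) = 1 := by rw [hβ]; exact inv_mul_cancel₀ hden.ne'
  set x : ℝ → ℝ := fun s => β * (d s 1 - ι * d s 0) with hxdef
  set v : ℝ → ℝ := fun s => β * (-θ * d s 0 - ι * d s 1) with hvdef
  have hxd : ∀ s, 0 ≤ s → HasDerivAt x (v s) s := fun s hs =>
    ((hd2 s hs).sub ((hd1 s hs).const_mul ι)).const_mul β
  have hvd : ∀ s, 0 ≤ s → HasDerivAt v (-θ * x s) s := by
    intro s hs
    refine ((((hd1 s hs).const_mul (-θ)).sub ((hd2 s hs).const_mul ι)).const_mul β).congr_deriv ?_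
    simp only [hxdef]; ring
  have hE : ∀ s, 0 ≤ s → θ * x s ^ 2 + v s ^ 2 = β * E₀ := by
    intro s hs
    rw [← hEconst s hs]
    simp only [hxdef, hvdef]
    linear_combination (β * (θ * (d s 0 * d s 0) + d s 1 * d s 1)) * hβ1
  have hEpos : 0 < β * E₀ := by positivity
  obtain ⟨X, hX⟩ : ∃ X : ℝ, X = 1 + β * E₀ + β * E₀ / θ := ⟨_, rfl⟩
  have hEθ : 0 < β * E₀ / θ := by positivity
  have hXpos : 0 < X := by rw [hX]; linarith
  have hx : ∀ s, 0 ≤ s → |x s| ≤ X := by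
    intro s hs
    have h1 : x s ^ 2 ≤ β * E₀ / θ := by
      rw [le_div_iff₀ hθ]; nlinarith [hE s hs, sq_nonneg (v s)]
    nlinarith [sq_abs (x s), sq_nonneg (|x s| - 1)]
  have hv : ∀ s, 0 ≤ s → |v s| ≤ X := by
    intro s hs
    have h1 : v s ^ 2 ≤ β * E₀ := by
      have := mul_nonneg hθ.le (sq_nonneg (x s))
      linarith [hE s hs]
    nlinarith [sq_abs (v s), sq_nonneg (|v s| - 1)]
  set η : ℝ → ℝ := fun s => ξ s - x s with hηdef
  have hηd : ∀ s, 0 ≤ s → HasDerivAt η (-ι * η s + (-1) * ζ s) s := by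
    intro s hs
    refine ((hξ s hs).sub (hxd s hs)).congr_deriv ?_
    simp only [hηdef, hxdef, hvdef, hyd]
    linear_combination (d s 0) * hβ1
  set p : ℝ → ℝ := fun s => d s 1 - ι * d s 0 - θ * ξ s - φ s with hpdef
  have hpd : ∀ s, 0 ≤ s → HasDerivAt p (-ι * p s + (θ + ι ^ 2) * ζ s) s := by
    intro s hs
    refine ((((hd2 s hs).sub ((hd1 s hs).const_mul ι)).sub
      ((hξ s hs).const_mul θ)).sub (hφ s hs)).congr_deriv ?_
    simp only [hpdef, hyd]
    ring
  obtain ⟨M₁, hM₁, m₁, hm₁, hη⟩ := aoc_filter η ζ ι (-1) C₀ c₀ hι hC₀ hc₀ hζ' hηd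
  obtain ⟨M₂, hM₂, m₂, hm₂, hp⟩ := aoc_filter p ζ ι (θ + ι ^ 2) C₀ c₀ hι hC₀ hc₀ hζ' hpd
  obtain ⟨K, hK⟩ : ∃ K : ℝ, K = M₁ + M₂ + C₀ := ⟨_, rfl⟩
  have hKpos : 0 < K := by rw [hK]; positivity
  obtain ⟨c, hc, hc1, hc2, hc3⟩ : ∃ c : ℝ, 0 < c ∧ c ≤ m₁ ∧ c ≤ m₂ ∧ c ≤ c₀ :=
    ⟨min m₁ (min m₂ c₀), lt_min hm₁ (lt_min hm₂ hc₀), min_le_left _ _,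
      (min_le_right _ _).trans (min_le_left _ _), (min_le_right _ _).trans (min_le_right _ _)⟩
  have hη' : ∀ s, 0 ≤ s → |η s| ≤ K * Real.exp (-c * s) := fun s hs =>
    (hη s hs).trans (aoc_widen hKpos (by rw [hK]; linarith) hc1 hs)
  have hp' : ∀ s, 0 ≤ s → |p s| ≤ K * Real.exp (-c * s) := fun s hs =>
    (hp s hs).trans (aoc_widen hKpos (by rw [hK]; linarith) hc2 hs)
  have hζ'' : ∀ s, 0 ≤ s → |ζ s| ≤ K * Real.exp (-c * s) := fun s hs =>
    (hζ' s hs).trans (aoc_widen hKpos (by rw [hK]; linarith) hc3 hs)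
  set e : ℝ → ℝ := fun s => d s 0 - χ₁ s with hedef
  set q : ℝ → ℝ := fun s => θ - θhat s with hqdef
  set r₁ : ℝ → ℝ := fun s => q s * η s + p s - (ι + k₀) * ζ s with hr₁def
  set r₂ : ℝ → ℝ := fun s => -(k₁ * (η s * e s + x s * ζ s + η s * ζ s)) with hr₂def
  have hed : ∀ s, 0 ≤ s → HasDerivAt e (-k₀ * e s + q s * x s + r₁ s) s := by
    intro s hs
    refine ((hd1 s hs).sub (hχ₁ s hs)).congr_deriv ?_
    simp only [hr₁def, hqdef, hedef, hpdef, hηdef, hyd]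
    ring
  have hqd : ∀ s, 0 ≤ s → HasDerivAt q (-k₁ * x s * e s + r₂ s) s := by
    intro s hs
    refine ((hθhat s hs).const_sub θ).congr_deriv ?_
    simp only [hr₂def, hedef, hηdef, hyd]
    ring
  have hexp1 : ∀ s, 0 ≤ s → Real.exp (-c * s) ≤ 1 := by
    intro s hs
    apply Real.exp_le_one_iff.mpr; nlinarith
  obtain ⟨J, hJ⟩ : ∃ J : ℝ, J = (1 + ι + k₀) + k₁ * (1 + X + K) := ⟨_, rfl⟩
  have hJpos : 0 < J := by rw [hJ]; positivity
  have hJ1 : 1 + ι + k₀ ≤ J := by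
    have : 0 < k₁ * (1 + X + K) := by positivity
    linarith
  have hJ2 : k₁ * (1 + X + K) ≤ J := by linarith
  have hr₁ : ∀ s, 0 ≤ s → |r₁ s| ≤ J * K * Real.exp (-c * s) * (1 + |e s| + |q s|) := by
    intro s hs
    obtain ⟨R, hR⟩ : ∃ R : ℝ, R = K * Real.exp (-c * s) := ⟨_, rfl⟩
    have hRpos : 0 < R := by rw [hR]; positivity
    have g1 := hη' s hs
    have g2 := hp' s hs
    have g3 := hζ'' s hs
    rw [← hR] at g1 g2 g3
    rw [mul_assoc J K, ← hR]
    have a1 : |q s * η s| ≤ |q s| * R := by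
      rw [abs_mul]; exact mul_le_mul_of_nonneg_left g1 (abs_nonneg _)
    have a2 : |(ι + k₀) * ζ s| ≤ (ι + k₀) * R := by
      rw [abs_mul, abs_of_pos (by linarith : 0 < ι + k₀)]
      exact mul_le_mul_of_nonneg_left g3 (by linarith)
    have a3 : |r₁ s| ≤ |q s| * R + R + (ι + k₀) * R :=
      (abs_sub _ _).trans (add_le_add ((abs_add_le _ _).trans (add_le_add a1 g2)) a2)
    have a4 : (1 + ι + k₀) * R * (1 + |e s| + |q s|) ≤ J * R * (1 + |e s| + |q s|) := by
      gcongr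
    have a5 : 0 ≤ (ι + k₀) * R * |q s| := by positivity
    have a6 : 0 ≤ (1 + ι + k₀) * R * |e s| := by positivity
    linarith
  have hr₂ : ∀ s, 0 ≤ s → |r₂ s| ≤ J * K * Real.exp (-c * s) * (1 + |e s| + |q s|) := by
    intro s hs
    obtain ⟨R, hR⟩ : ∃ R : ℝ, R = K * Real.exp (-c * s) := ⟨_, rfl⟩
    have hRpos : 0 < R := by rw [hR]; positivity
    have hRK : R ≤ K := by rw [hR]; exact mul_le_of_le_one_right hKpos.le (hexp1 s hs)
    have g1 := hη' s hs
    have g3 := hζ'' s hs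
    rw [← hR] at g1 g3
    rw [mul_assoc J K, ← hR]
    have a1 : |η s * e s| ≤ R * |e s| := by
      rw [abs_mul]; exact mul_le_mul_of_nonneg_right g1 (abs_nonneg _)
    have a2 : |x s * ζ s| ≤ X * R := by
      rw [abs_mul]; exact mul_le_mul (hx s hs) g3 (abs_nonneg _) hXpos.le
    have a3 : |η s * ζ s| ≤ K * R := by
      rw [abs_mul]; exact mul_le_mul (g1.trans hRK) g3 (abs_nonneg _) hKpos.le
    have a4 : |r₂ s| ≤ k₁ * (R * |e s| + X * R + K * R) := by
      simp only [hr₂def]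
      rw [abs_neg, abs_mul, abs_of_pos hk₁]
      apply mul_le_mul_of_nonneg_left _ hk₁.le
      exact (abs_add_le _ _).trans (add_le_add ((abs_add_le _ _).trans (add_le_add a1 a2)) a3)
    have a5 : k₁ * (1 + X + K) * R * (1 + |e s| + |q s|) ≤ J * R * (1 + |e s| + |q s|) := by
      gcongr
    have a6 : 0 ≤ k₁ * (1 + X + K) * R * |q s| := by positivity
    have a7 : 0 ≤ k₁ * (X + K) * R * |e s| := by positivity
    have a8 : 0 ≤ k₁ * R := by positivity
    linarith
  obtain ⟨M, hM, m, hm, hfin⟩ := aoc_core θ (β * E₀) X k₀ k₁ (J * K) c hθ hEpos hXpos hk₀' hk₁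
    (by positivity) hc x v e q r₁ r₂ hxd hvd hed hqd hE hx hv hr₁ hr₂
  obtain ⟨μ, hμ, hμ1, hμ2⟩ : ∃ μ : ℝ, 0 < μ ∧ μ ≤ m ∧ μ ≤ c :=
    ⟨min m c, lt_min hm hc, min_le_left _ _, min_le_right _ _⟩
  obtain ⟨Q, hQ⟩ : ∃ Q : ℝ, Q = M + 3 * (K ^ 2 + (X + K) ^ 2 * M + ι ^ 2 * M) := ⟨_, rfl⟩
  have hQpos : 0 < Q := by rw [hQ]; positivity
  have hsqrt : ∀ s, Real.sqrt (Q * Real.exp (-μ * s)) = Real.sqrt Q * Real.exp (-(μ / 2) * s) := by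
    intro s
    have h2 : Real.exp (-μ * s) = Real.exp (-(μ/2) * s) ^ 2 := by
      rw [← Real.exp_nat_mul]; congr 1; push_cast; ring
    rw [Real.sqrt_mul hQpos.le, h2, Real.sqrt_sq (Real.exp_pos _).le]
  refine ⟨Real.sqrt Q, Real.sqrt_pos.mpr hQpos, μ / 2, by positivity, fun s hs => ?_⟩
  have hs0 : 0 ≤ s := hs
  have hF : e s ^ 2 + q s ^ 2 ≤ M * Real.exp (-μ * s) :=
    (hfin s hs0).trans (aoc_widen hM le_rfl hμ1 hs0)
  have hpF : |p s| ≤ K * Real.exp (-μ * s) := (hp' s hs0).trans (aoc_widen hKpos le_rfl hμ2 hs0)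
  obtain ⟨ε, hε⟩ : ∃ ε : ℝ, ε = Real.exp (-μ * s) := ⟨_, rfl⟩
  have hεpos : 0 < ε := by rw [hε]; exact Real.exp_pos _
  have hε1 : ε ≤ 1 := by
    rw [hε]; apply Real.exp_le_one_iff.mpr
    have := mul_nonneg hμ.le hs0
    linarith
  rw [← hsqrt]
  rw [← hε] at hF hpF ⊢
  have hq2 : q s ^ 2 ≤ M * ε := by linarith [sq_nonneg (e s)]
  have he2 : e s ^ 2 ≤ M * ε := by linarith [sq_nonneg (q s)]
  have hp2 : p s ^ 2 ≤ K ^ 2 * ε := by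
    have h1 : p s ^ 2 ≤ (K * ε) ^ 2 := by rw [← sq_abs (p s)]; gcongr
    have h2 : K ^ 2 * (ε * ε) ≤ K ^ 2 * (1 * ε) := by gcongr
    linarith
  have hξ2 : ξ s ^ 2 ≤ (X + K) ^ 2 := by
    have h1 : |ξ s| ≤ X + K := by
      have h2 : ξ s = x s + η s := by simp only [hηdef]; ring
      rw [h2]
      refine (abs_add_le _ _).trans (add_le_add (hx s hs0) ((hη' s hs0).trans ?_))
      exact mul_le_of_le_one_right hKpos.le (hexp1 s hs0)
    rw [← sq_abs (ξ s)]; gcongr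
  have hξq : ξ s ^ 2 * q s ^ 2 ≤ (X + K) ^ 2 * (M * ε) :=
    mul_le_mul hξ2 hq2 (sq_nonneg _) (sq_nonneg _)
  have hιe : ι ^ 2 * e s ^ 2 ≤ ι ^ 2 * (M * ε) := mul_le_mul_of_nonneg_left he2 (sq_nonneg _)
  have hQε : Q * ε = M * ε + 3 * (K ^ 2 * ε + (X + K) ^ 2 * (M * ε) + ι ^ 2 * (M * ε)) := by
    rw [hQ]; ring
  constructor
  · apply Real.abs_le_sqrt
    have h1 : (θhat s - θ) ^ 2 = q s ^ 2 := by simp only [hqdef]; ring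
    have h2 : 0 ≤ K ^ 2 * ε := by positivity
    have h3 : 0 ≤ (X + K) ^ 2 * (M * ε) := by positivity
    have h4 : 0 ≤ ι ^ 2 * (M * ε) := by positivity
    rw [h1, hQε]; linarith
  · apply Real.sqrt_le_sqrt
    have h0 : dhat s 0 - d s 0 = - e s := by rw [hdhat]; simp [hedef]
    have h1 : dhat s 1 - d s 1 = - (p s + ξ s * q s + ι * e s) := by
      rw [hdhat]
      simp only [hedef, hpdef, hqdef, Matrix.cons_val_one, Matrix.cons_val_fin_one]
      ring
    rw [h0, h1, hQε]
    have h2 : (-(p s + ξ s * q s + ι * e s)) ^ 2 ≤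
        3 * (p s ^ 2 + ξ s ^ 2 * q s ^ 2 + ι ^ 2 * e s ^ 2) := by
      nlinarith [sq_nonneg (p s - ξ s * q s), sq_nonneg (p s - ι * e s),
        sq_nonneg (ξ s * q s - ι * e s)]
    have h3 : (- e s) ^ 2 = e s ^ 2 := by ring
    rw [h3]; linarith
end

section
/- Let 0 < c₂ < 1. There exist constants M₂ ≥ 1 and μ₂ > 0 such that the following holds: for every pair of functions z̃ : [0,1] × [0,∞) → ℝ (twice continuously differentiable) and Ỹ₂ : [0,1] × [0,∞) → ℝ (continuously differentiable) satisfying z̃_ss(x,s) = z̃_xx(x,s) on (0,1) × (0,∞), z̃_x(0,s) = 0, z̃(1,s) = −Ỹ₂(1,s), Ỹ₂_s(x,s) = −Ỹ₂_x(x,s) on (0,1) × (0,∞), and Ỹ₂(0,s) = −c₂·z̃(0,s) for all s ≥ 0, one has N(s) ≤ M₂·e^{−μ₂ s}·N(0) for all s ≥ 0, where N(s)² = ∫₀¹ [z̃_x(x,s)² + z̃_s(x,s)² + Ỹ₂(x,s)² + Ỹ₂_x(x,s)²] dx. -/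
/- STATEMENT 16: uniform exponential decay of the coupled observer-error system:
a wave equation z̃_ss = z̃_xx with z̃_x(0,s) = 0, z̃(1,s) = −Ỹ₂(1,s), coupled with a
transport equation Ỹ₂_s = −Ỹ₂_x with Ỹ₂(0,s) = −c₂ z̃(0,s), 0 < c₂ < 1. The energy
N(s) = (∫₀¹ [z̃_x² + z̃_s² + Ỹ₂² + Ỹ₂ₓ²] dx)^{1/2} satisfies
N(s) ≤ M₂ e^{−μ₂ s} N(0) with constants depending only on c₂. -/

open Set

/-- the H¹×L²×H¹ energy norm of the observer-error system. -/
noncomputable def observerErrorNorm (ztil Ytil : ℝ → ℝ → ℝ) (s : ℝ) : ℝ :=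
  Real.sqrt (∫ x in (0:ℝ)..1,
    ((deriv (fun y => ztil y s) x) ^ 2 + (deriv (ztil x) s) ^ 2
      + (Ytil x s) ^ 2 + (deriv (fun y => Ytil y s) x) ^ 2))


open Function

lemma oe_dx (f : ℝ → ℝ → ℝ) (hf : Differentiable ℝ (uncurry f)) (x s : ℝ) :
    HasDerivAt (fun y => f y s) (fderiv ℝ (uncurry f) (x, s) (1, 0)) x := by
  have h1 : HasDerivAt (fun y : ℝ => (y, s)) ((1:ℝ), (0:ℝ)) x :=
    (hasDerivAt_id x).prodMk (hasDerivAt_const x s)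
  exact ((hf (x, s)).hasFDerivAt).comp_hasDerivAt x h1

lemma oe_ds (f : ℝ → ℝ → ℝ) (hf : Differentiable ℝ (uncurry f)) (x s : ℝ) :
    HasDerivAt (f x) (fderiv ℝ (uncurry f) (x, s) (0, 1)) s := by
  have h1 : HasDerivAt (fun t : ℝ => (x, t)) ((0:ℝ), (1:ℝ)) s :=
    (hasDerivAt_const s x).prodMk (hasDerivAt_id s)
  exact ((hf (x, s)).hasFDerivAt).comp_hasDerivAt s h1

lemma oe_transport (f : ℝ → ℝ → ℝ) (hf : Differentiable ℝ (uncurry f)) (e : ℝ)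
    (x s h : ℝ) (hh : 0 ≤ h)
    (hpde : ∀ t ∈ Ioo (0:ℝ) h, deriv (f (x + e * t)) (s + t)
      + e * deriv (fun y => f y (s + t)) (x + e * t) = 0) :
    f (x + e * h) (s + h) = f x s := by
  rcases hh.eq_or_lt with rfl | hh
  · simp
  have hg : ∀ t, HasDerivAt (fun t => f (x + e * t) (s + t))
      (deriv (f (x + e * t)) (s + t) + e * deriv (fun y => f y (s + t)) (x + e * t)) t := by
    intro t
    have h1 : HasDerivAt (fun t : ℝ => (x + e * t, s + t)) (e, (1:ℝ)) t := by
      refine HasDerivAt.prodMk ?_ ?_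
      · simpa using ((hasDerivAt_id t).const_mul e).const_add x
      · simpa using (hasDerivAt_id t).const_add s
    have h2 := ((hf (x + e * t, s + t)).hasFDerivAt).comp_hasDerivAt t h1
    rw [(oe_dx f hf _ _).deriv, (oe_ds f hf _ _).deriv]
    refine h2.congr_deriv ?_
    have : ((e, (1:ℝ)) : ℝ × ℝ) = (0, 1) + e • (1, 0) := by simp
    rw [this, map_add, map_smul]; simp
  obtain ⟨t, ht, h3⟩ := exists_deriv_eq_slope (fun t => f (x + e * t) (s + t)) hh
    (fun t _ => (hg t).continuousAt.continuousWithinAt)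
    (fun t _ => (hg t).differentiableAt.differentiableWithinAt)
  rw [(hg t).deriv, hpde t ht] at h3
  have hne : h - 0 ≠ 0 := by simpa using hh.ne'
  have h4 := (div_eq_zero_iff.mp h3.symm).resolve_right hne
  simpa [sub_eq_zero] using h4

lemma oe_closure (G : ℝ → ℝ → ℝ) (hG : Continuous (uncurry G))
    (h0 : ∀ x ∈ Ioo (0:ℝ) 1, ∀ s ∈ Ioi (0:ℝ), G x s = 0) :
    ∀ x ∈ Icc (0:ℝ) 1, ∀ s ∈ Ici (0:ℝ), G x s = 0 := by
  intro x hx s hs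
  have hcl : IsClosed {p : ℝ × ℝ | uncurry G p = 0} := isClosed_eq hG continuous_const
  have hsub : (Ioo (0:ℝ) 1) ×ˢ (Ioi (0:ℝ)) ⊆ {p : ℝ × ℝ | uncurry G p = 0} := by
    rintro ⟨a, b⟩ ⟨ha, hb⟩
    exact h0 a ha b hb
  have := closure_minimal hsub hcl
  rw [closure_prod_eq, closure_Ioo (by norm_num), closure_Ioi] at this
  exact this (show (x, s) ∈ _ from ⟨hx, hs⟩)

lemma oe_cd_x (z : ℝ → ℝ → ℝ) (n : ℕ) (hz : ContDiff ℝ (n+1) (uncurry z)) :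
    ContDiff ℝ n (uncurry (fun x s => deriv (fun y => z y s) x)) := by
  have hd : Differentiable ℝ (uncurry z) := hz.differentiable (by simp)
  have : uncurry (fun x s => deriv (fun y => z y s) x)
      = fun p : ℝ × ℝ => fderiv ℝ (uncurry z) p (1, 0) := by
    ext ⟨x, s⟩; exact (oe_dx z hd x s).deriv
  rw [this]
  exact (hz.fderiv_right le_rfl).clm_apply contDiff_const

lemma oe_cd_s (z : ℝ → ℝ → ℝ) (n : ℕ) (hz : ContDiff ℝ (n+1) (uncurry z)) :
    ContDiff ℝ n (uncurry (fun x s => deriv (z x) s)) := by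
  have hd : Differentiable ℝ (uncurry z) := hz.differentiable (by simp)
  have : uncurry (fun x s => deriv (z x) s)
      = fun p : ℝ × ℝ => fderiv ℝ (uncurry z) p (0, 1) := by
    ext ⟨x, s⟩; exact (oe_ds z hd x s).deriv
  rw [this]
  exact (hz.fderiv_right le_rfl).clm_apply contDiff_const

lemma oe_mixed (z : ℝ → ℝ → ℝ) (hz : ContDiff ℝ 2 (uncurry z)) (x s : ℝ) :
    deriv (fun t => deriv (fun y => z y t) x) s = deriv (fun y => deriv (z y) s) x := by
  have hd : Differentiable ℝ (uncurry z) := hz.differentiable (by simp)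
  have hd2 : Differentiable ℝ (fderiv ℝ (uncurry z)) :=
    (hz.fderiv_right (m := 1) (by norm_num)).differentiable (by simp)
  have e1 : (fun t => deriv (fun y => z y t) x) = fun t => fderiv ℝ (uncurry z) (x, t) (1, 0) := by
    ext t; exact (oe_dx z hd x t).deriv
  have e2 : (fun y => deriv (z y) s) = fun y => fderiv ℝ (uncurry z) (y, s) (0, 1) := by
    ext t; exact (oe_ds z hd t s).deriv
  rw [e1, e2]
  have h1 : HasDerivAt (fun y : ℝ => (y, s)) ((1:ℝ), (0:ℝ)) x :=
    (hasDerivAt_id x).prodMk (hasDerivAt_const x s)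
  have h2 : HasDerivAt (fun t : ℝ => (x, t)) ((0:ℝ), (1:ℝ)) s :=
    (hasDerivAt_const s x).prodMk (hasDerivAt_id s)
  have k (v : ℝ × ℝ) : HasFDerivAt (fun p => fderiv ℝ (uncurry z) p v)
      ((fderiv ℝ (fderiv ℝ (uncurry z)) (x, s)).flip v) (x, s) := by
    simpa using (hd2 (x, s)).hasFDerivAt.clm_apply (hasFDerivAt_const v (x, s))
  have k1 := ((k (0, 1)).comp_hasDerivAt x h1).deriv
  have k2 := ((k (1, 0)).comp_hasDerivAt s h2).deriv
  have hs : IsSymmSndFDerivAt ℝ (uncurry z) (x, s) :=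
    hz.contDiffAt.isSymmSndFDerivAt (by simp)
  refine Eq.trans k2 (Eq.trans ?_ k1.symm)
  exact hs.eq _ _

lemma oe_deriv_eq (f g : ℝ → ℝ) (a s : ℝ) (hs : a ≤ s) (hf : DifferentiableAt ℝ f s)
    (hg : DifferentiableAt ℝ g s) (h : ∀ t, a ≤ t → f t = g t) : deriv f s = deriv g s := by
  have hu : UniqueDiffWithinAt ℝ (Ici a) s := uniqueDiffOn_Ici a s hs
  rw [← hf.derivWithin hu, ← hg.derivWithin hu]
  exact derivWithin_congr (fun t ht => h t ht) (h s hs)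

lemma oe_int1 (F f g : ℝ → ℝ) (h : ℝ) (h0 : 0 ≤ h) (h1 : h ≤ 1) (hF : Continuous F)
    (hf : Continuous f) (hg : Continuous g) (f0 : ∀ x, 0 ≤ f x) (g0 : ∀ x, 0 ≤ g x)
    (hl : ∀ x, 0 ≤ x → x ≤ 1 - h → F x ≤ f (x + h))
    (hr : ∀ x, 1 - h ≤ x → x ≤ 1 → F x ≤ g (2 - h - x)) :
    ∫ x in (0:ℝ)..1, F x ≤ (∫ x in (0:ℝ)..1, f x) + ∫ x in (0:ℝ)..1, g x := by
  rw [← intervalIntegral.integral_add_adjacent_intervals (a := 0) (b := 1 - h) (c := 1)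
    (hF.intervalIntegrable _ _) (hF.intervalIntegrable _ _)]
  refine add_le_add ?_ ?_
  · calc _ ≤ ∫ x in (0:ℝ)..(1-h), f (x + h) :=
          intervalIntegral.integral_mono_on (by linarith) (hF.intervalIntegrable _ _)
            (Continuous.intervalIntegrable (by fun_prop) _ _) (fun x hx => hl x hx.1 hx.2)
      _ = ∫ x in h..1, f x := by
          rw [intervalIntegral.integral_comp_add_right]; simp
      _ ≤ _ := intervalIntegral.integral_mono_interval h0 h1 le_rfl
          (Filter.Eventually.of_forall f0) (hf.intervalIntegrable _ _)
  · calc _ ≤ ∫ x in (1-h)..1, g (2 - h - x) :=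
          intervalIntegral.integral_mono_on (by linarith) (hF.intervalIntegrable _ _)
            (Continuous.intervalIntegrable (by fun_prop) _ _) (fun x hx => hr x hx.1 hx.2)
      _ = ∫ x in (1-h)..1, g x := by
          rw [intervalIntegral.integral_comp_sub_left]; congr 1 <;> ring
      _ ≤ _ := intervalIntegral.integral_mono_interval (by linarith) (by linarith) le_rfl
          (Filter.Eventually.of_forall g0) (hg.intervalIntegrable _ _)

lemma oe_int2 (F f g : ℝ → ℝ) (h : ℝ) (h0 : 0 ≤ h) (h1 : h ≤ 1) (hF : Continuous F)
    (hf : Continuous f) (hg : Continuous g) (f0 : ∀ x, 0 ≤ f x) (g0 : ∀ x, 0 ≤ g x)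
    (hl : ∀ x, h ≤ x → x ≤ 1 → F x ≤ f (x - h))
    (hr : ∀ x, 0 ≤ x → x ≤ h → F x ≤ g (h - x)) :
    ∫ x in (0:ℝ)..1, F x ≤ (∫ x in (0:ℝ)..1, f x) + ∫ x in (0:ℝ)..1, g x := by
  have := oe_int1 (fun x => F (1 - x)) (fun x => f (1 - x)) (fun x => g (1 - x)) h h0 h1
    (by fun_prop) (by fun_prop) (by fun_prop) (fun x => f0 _) (fun x => g0 _)
    (fun x a b => by
      have := hl (1 - x) (by linarith) (by linarith)
      rwa [show 1 - x - h = 1 - (x + h) by ring] at this)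
    (fun x a b => by
      have := hr (1 - x) (by linarith) (by linarith)
      rwa [show h - (1 - x) = 1 - (2 - h - x) by ring] at this)
  simpa [intervalIntegral.integral_comp_sub_left] using this

lemma oe_cs (f : ℝ → ℝ) (hf : Continuous f) :
    (∫ x in (0:ℝ)..1, f x) ^ 2 ≤ ∫ x in (0:ℝ)..1, f x ^ 2 := by
  set m := ∫ x in (0:ℝ)..1, f x with hm
  have h : ∫ x in (0:ℝ)..1, (2 * m * f x - m ^ 2) ≤ ∫ x in (0:ℝ)..1, f x ^ 2 :=
    intervalIntegral.integral_mono_on (by norm_num)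
      (Continuous.intervalIntegrable (by fun_prop) _ _)
      (Continuous.intervalIntegrable (by fun_prop) _ _)
      (fun x _ => by nlinarith [sq_nonneg (f x - m)])
  rw [intervalIntegral.integral_sub (Continuous.intervalIntegrable (by fun_prop) _ _) (by simp),
    intervalIntegral.integral_const_mul, ← hm] at h
  simp at h
  nlinarith

/-- decay from a two-step contraction and a one-step bound. -/
lemma oe_decay (k C : ℝ) (hk : k < 1) (hC : 1 ≤ C) :
    ∃ M ≥ (1:ℝ), ∃ μ > (0:ℝ), ∀ E : ℝ → ℝ, (∀ s, 0 ≤ E s) →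
      (∀ s, 0 ≤ s → ∀ h, 0 ≤ h → h ≤ 1 → E (s + h) ≤ C * E s) →
      (∀ s, 1 ≤ s → E (s + 2) = k * E s) →
      ∀ s, 0 ≤ s → E s ≤ M * Real.exp (-(2 * μ) * s) * E 0 := by
  set ρ := max k (1/2) with hρ
  have hρ1 : ρ < 1 := max_lt hk (by norm_num)
  have hρ0 : 0 < ρ := lt_of_lt_of_le (by norm_num) (le_max_right _ _)
  have hkρ : k ≤ ρ := le_max_left _ _
  have hlog : Real.log ρ < 0 := Real.log_neg hρ0 hρ1
  set μ := - Real.log ρ / 4 with hμ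
  have hμ0 : 0 < μ := by rw [hμ]; linarith
  have hexp : Real.exp (-(4 * μ)) = ρ := by
    rw [hμ, show -(4 * (-Real.log ρ / 4)) = Real.log ρ by ring, Real.exp_log hρ0]
  refine ⟨C ^ 3 * Real.exp (6 * μ), ?_, μ, hμ0, ?_⟩
  · exact one_le_mul_of_one_le_of_one_le (one_le_pow₀ hC) (Real.one_le_exp (by positivity))
  intro E hE h1 h2
  have key : ∀ n : ℕ, ∀ s : ℝ, 0 ≤ s → s ≤ 3 + 2 * n →
      E s ≤ C ^ 3 * Real.exp (6 * μ) * Real.exp (-(2 * μ) * s) * E 0 := by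
    intro n
    induction n with
    | zero =>
      intro s hs hs3
      simp at hs3
      have a1 := h1 0 le_rfl (s / 3) (by linarith) (by linarith)
      have a2 := h1 (0 + s / 3) (by linarith) (s / 3) (by linarith) (by linarith)
      have a3 := h1 (0 + s / 3 + s / 3) (by linarith) (s / 3) (by linarith) (by linarith)
      rw [show 0 + s / 3 + s / 3 + s / 3 = s by ring] at a3
      have hb : E s ≤ C ^ 3 * E 0 := by
        calc _ ≤ _ := a3
          _ ≤ C * (C * (C * E 0)) := by gcongr; exact a2.trans (by gcongr)
          _ = _ := by ring
      have : 1 ≤ Real.exp (6 * μ) * Real.exp (-(2 * μ) * s) := by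
        rw [← Real.exp_add]; apply Real.one_le_exp; nlinarith
      have hp : 0 ≤ C ^ 3 * E 0 := mul_nonneg (by positivity) (hE 0)
      nlinarith
    | succ n ih =>
      intro s hs hs3
      by_cases hc : s ≤ 3 + 2 * n
      · exact ih s hs hc
      push_cast at hs3
      push Not at hc
      have hn : (0:ℝ) ≤ n := Nat.cast_nonneg n
      have a1 := ih (s - 2) (by linarith) (by linarith)
      have a2 := h2 (s - 2) (by linarith)
      rw [sub_add_cancel] at a2
      rw [a2]
      calc _ ≤ ρ * E (s - 2) := mul_le_mul_of_nonneg_right hkρ (hE _)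
        _ ≤ ρ * _ := mul_le_mul_of_nonneg_left a1 hρ0.le
        _ = _ := by
          rw [show -(2 * μ) * (s - 2) = 4 * μ + -(2 * μ) * s by ring, Real.exp_add, ← hexp,
            Real.exp_neg]
          field_simp
  intro s hs
  obtain ⟨n, hn⟩ := exists_nat_ge s
  exact key n s hs (by have : (0:ℝ) ≤ n := Nat.cast_nonneg n
                       linarith)

lemma oe_step (c : ℝ) (hc0 : 0 < c) (hc1 : c < 1) (p q u : ℝ → ℝ → ℝ)
    (cp : ∀ s, Continuous (fun x => p x s)) (cq : ∀ s, Continuous (fun x => q x s))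
    (cu : ∀ s, Continuous (fun x => u x s))
    (hp : ∀ x h s, 0 ≤ x → 0 ≤ h → x + h ≤ 1 → 0 ≤ s → p x (s + h) = p (x + h) s)
    (hq : ∀ x h s, 0 ≤ x → 0 ≤ h → x + h ≤ 1 → 0 ≤ s → q (x + h) (s + h) = q x s)
    (hu : ∀ x h s, 0 ≤ x → 0 ≤ h → x + h ≤ 1 → 0 ≤ s → u (x + h) (s + h) = u x s)
    (bq : ∀ s, 0 ≤ s → q 0 s = p 0 s) (bu : ∀ s, 0 ≤ s → u 0 s = -c * p 0 s)
    (bp : ∀ s, 0 ≤ s → p 1 s = -2 * u 1 s - q 1 s)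
    (s : ℝ) (hs : 0 ≤ s) (h : ℝ) (h0 : 0 ≤ h) (h1 : h ≤ 1) :
    ∫ x in (0:ℝ)..1, (p x (s + h) ^ 2 + q x (s + h) ^ 2 + u x (s + h) ^ 2)
      ≤ 9 * ∫ x in (0:ℝ)..1, (p x s ^ 2 + q x s ^ 2 + u x s ^ 2) := by
  have cp' := cp s
  have cq' := cq s
  have cu' := cu s
  have cp2 := cp (s + h)
  have cq2 := cq (s + h)
  have cu2 := cu (s + h)
  have Ip : ∫ x in (0:ℝ)..1, p x (s + h) ^ 2
      ≤ (∫ x in (0:ℝ)..1, p x s ^ 2) + ∫ x in (0:ℝ)..1, (8 * u x s ^ 2 + 2 * q x s ^ 2) := by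
    refine oe_int1 _ _ _ h h0 h1 (by fun_prop) (by fun_prop) (by fun_prop)
      (fun x => by positivity) (fun x => by positivity) ?_ ?_
    · intro x a b
      rw [hp x h s a h0 (by linarith) hs]
    · intro x a b
      have e1 := hp x (1 - x) (s + h - (1 - x)) (by linarith) (by linarith) (by linarith)
        (by linarith)
      have e2 := bp (s + h - (1 - x)) (by linarith)
      have e3 := hq (2 - h - x) (h + x - 1) s (by linarith) (by linarith) (by linarith) hs
      have e4 := hu (2 - h - x) (h + x - 1) s (by linarith) (by linarith) (by linarith) hs
      rw [show s + h - (1 - x) + (1 - x) = s + h by ring, show x + (1 - x) = 1 by ring] at e1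
      rw [show 2 - h - x + (h + x - 1) = 1 by ring,
        show s + (h + x - 1) = s + h - (1 - x) by ring] at e3 e4
      rw [e1, e2, e3, e4]
      nlinarith [sq_nonneg (2 * u (2 - h - x) s - q (2 - h - x) s)]
  have Iq : ∫ x in (0:ℝ)..1, q x (s + h) ^ 2
      ≤ (∫ x in (0:ℝ)..1, q x s ^ 2) + ∫ x in (0:ℝ)..1, p x s ^ 2 := by
    refine oe_int2 _ _ _ h h0 h1 (by fun_prop) (by fun_prop) (by fun_prop)
      (fun x => by positivity) (fun x => by positivity) ?_ ?_
    · intro x a b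
      have := hq (x - h) h s (by linarith) h0 (by linarith) hs
      rw [sub_add_cancel] at this
      rw [this]
    · intro x a b
      have e1 := hq 0 x (s + h - x) le_rfl a (by linarith) (by linarith)
      have e2 := hp 0 (h - x) s le_rfl (by linarith) (by linarith) hs
      rw [bq _ (by linarith), zero_add, sub_add_cancel] at e1
      rw [zero_add, show s + (h - x) = s + h - x by ring] at e2
      rw [e1, e2]
  have Iu : ∫ x in (0:ℝ)..1, u x (s + h) ^ 2
      ≤ (∫ x in (0:ℝ)..1, u x s ^ 2) + ∫ x in (0:ℝ)..1, p x s ^ 2 := by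
    refine oe_int2 _ _ _ h h0 h1 (by fun_prop) (by fun_prop) (by fun_prop)
      (fun x => by positivity) (fun x => by positivity) ?_ ?_
    · intro x a b
      have := hu (x - h) h s (by linarith) h0 (by linarith) hs
      rw [sub_add_cancel] at this
      rw [this]
    · intro x a b
      have e1 := hu 0 x (s + h - x) le_rfl a (by linarith) (by linarith)
      have e2 := hp 0 (h - x) s le_rfl (by linarith) (by linarith) hs
      rw [bu _ (by linarith), zero_add, sub_add_cancel] at e1
      rw [zero_add, show s + (h - x) = s + h - x by ring] at e2
      rw [e1, e2, mul_pow]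
      exact mul_le_of_le_one_left (sq_nonneg _) (by nlinarith)
  have ip := Continuous.intervalIntegrable (μ := MeasureTheory.volume)
    (show Continuous (fun x => p x s ^ 2) by fun_prop) 0 1
  have iq := Continuous.intervalIntegrable (μ := MeasureTheory.volume)
    (show Continuous (fun x => q x s ^ 2) by fun_prop) 0 1
  have iu := Continuous.intervalIntegrable (μ := MeasureTheory.volume)
    (show Continuous (fun x => u x s ^ 2) by fun_prop) 0 1
  have ip2 := Continuous.intervalIntegrable (μ := MeasureTheory.volume)
    (show Continuous (fun x => p x (s + h) ^ 2) by fun_prop) 0 1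
  have iq2 := Continuous.intervalIntegrable (μ := MeasureTheory.volume)
    (show Continuous (fun x => q x (s + h) ^ 2) by fun_prop) 0 1
  have iu2 := Continuous.intervalIntegrable (μ := MeasureTheory.volume)
    (show Continuous (fun x => u x (s + h) ^ 2) by fun_prop) 0 1
  rw [intervalIntegral.integral_add (iu.const_mul 8) (iq.const_mul 2),
    intervalIntegral.integral_const_mul, intervalIntegral.integral_const_mul] at Ip
  rw [intervalIntegral.integral_add (ip2.add iq2) iu2, intervalIntegral.integral_add ip2 iq2,
    intervalIntegral.integral_add (ip.add iq) iu, intervalIntegral.integral_add ip iq]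
  have n1 : 0 ≤ ∫ x in (0:ℝ)..1, p x s ^ 2 :=
    intervalIntegral.integral_nonneg (by norm_num) (fun x _ => by positivity)
  have n2 : 0 ≤ ∫ x in (0:ℝ)..1, q x s ^ 2 :=
    intervalIntegral.integral_nonneg (by norm_num) (fun x _ => by positivity)
  linarith

lemma oe_contr (c : ℝ) (p q u : ℝ → ℝ → ℝ)
    (hp : ∀ x h s, 0 ≤ x → 0 ≤ h → x + h ≤ 1 → 0 ≤ s → p x (s + h) = p (x + h) s)
    (hq : ∀ x h s, 0 ≤ x → 0 ≤ h → x + h ≤ 1 → 0 ≤ s → q (x + h) (s + h) = q x s)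
    (hu : ∀ x h s, 0 ≤ x → 0 ≤ h → x + h ≤ 1 → 0 ≤ s → u (x + h) (s + h) = u x s)
    (bq : ∀ s, 0 ≤ s → q 0 s = p 0 s) (bu : ∀ s, 0 ≤ s → u 0 s = -c * p 0 s)
    (bp : ∀ s, 0 ≤ s → p 1 s = -2 * u 1 s - q 1 s)
    (s : ℝ) (hs : 1 ≤ s) :
    ∫ x in (0:ℝ)..1, (p x (s + 2) ^ 2 + q x (s + 2) ^ 2 + u x (s + 2) ^ 2)
      = (2 * c - 1) ^ 2 * ∫ x in (0:ℝ)..1, (p x s ^ 2 + q x s ^ 2 + u x s ^ 2) := by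
  have key : ∀ t, 0 ≤ t → p 0 (t + 2) = (2 * c - 1) * p 0 t := by
    intro t ht
    have e1 := hp 0 1 (t + 1) le_rfl (by norm_num) (by norm_num) (by linarith)
    have e2 := hq 0 1 t le_rfl (by norm_num) (by norm_num) ht
    have e3 := hu 0 1 t le_rfl (by norm_num) (by norm_num) ht
    rw [show t + 1 + 1 = t + 2 by ring, zero_add, bp _ (by linarith)] at e1
    rw [zero_add] at e2 e3
    rw [e1, e2, e3, bq t ht, bu t ht]; ring
  have kp : ∀ x ∈ Icc (0:ℝ) 1, ∀ s, 0 ≤ s → p x s = p 0 (s + x) := by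
    intro x hx s hs
    have := hp 0 x s le_rfl hx.1 (by linarith [hx.2]) hs
    rw [this, zero_add]
  have kq : ∀ x ∈ Icc (0:ℝ) 1, ∀ s, 1 ≤ s → q x s = p 0 (s - x) := by
    intro x hx s hs
    have := hq 0 x (s - x) le_rfl hx.1 (by linarith [hx.2]) (by linarith [hx.2])
    rwa [zero_add, sub_add_cancel, bq _ (by linarith [hx.2])] at this
  have ku : ∀ x ∈ Icc (0:ℝ) 1, ∀ s, 1 ≤ s → u x s = -c * p 0 (s - x) := by
    intro x hx s hs
    have := hu 0 x (s - x) le_rfl hx.1 (by linarith [hx.2]) (by linarith [hx.2])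
    rwa [zero_add, sub_add_cancel, bu _ (by linarith [hx.2])] at this
  rw [← intervalIntegral.integral_const_mul]
  refine intervalIntegral.integral_congr fun x hx => ?_
  rw [uIcc_of_le (by norm_num)] at hx
  rw [kp x hx _ (by linarith), kp x hx s (by linarith), kq x hx _ (by linarith), kq x hx s hs,
    ku x hx _ (by linarith), ku x hx s hs, show s + 2 + x = s + x + 2 by ring,
    show s + 2 - x = s - x + 2 by ring, key _ (by linarith [hx.1]), key _ (by linarith [hx.2])]
  ring

/-- The lower order term is dominated by the derivatives. -/
lemma oe_lower (c : ℝ) (hc0 : 0 < c) (hc1 : c < 1) (z Y a b : ℝ → ℝ)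
    (hz : ∀ x, HasDerivAt z (a x) x) (hY : ∀ x, HasDerivAt Y (b x) x)
    (ca : Continuous a) (cb : Continuous b) (h1 : z 1 = -Y 1) (h0 : Y 0 = -c * z 0)
    (x : ℝ) (hx : x ∈ Icc (0:ℝ) 1) :
    Y x ^ 2 ≤ 8 / (1 - c) ^ 2 * ∫ x in (0:ℝ)..1, (a x ^ 2 + b x ^ 2) := by
  have hc : 0 < 1 - c := by linarith
  set J := ∫ x in (0:ℝ)..1, (|a x| + |b x|) with hJ
  have ic {f : ℝ → ℝ} (hf : Continuous f) (r t : ℝ) :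
      IntervalIntegrable f MeasureTheory.volume r t := hf.intervalIntegrable _ _
  have e1 : ∫ x in (0:ℝ)..1, (a x + b x) = -((1 - c) * z 0) := by
    rw [intervalIntegral.integral_add (ic ca _ _) (ic cb _ _),
      intervalIntegral.integral_eq_sub_of_hasDerivAt (fun x _ => hz x) (ic ca _ _),
      intervalIntegral.integral_eq_sub_of_hasDerivAt (fun x _ => hY x) (ic cb _ _), h1, h0]
    ring
  have e2 : ∫ t in (0:ℝ)..x, b t = Y x + c * z 0 := by
    rw [intervalIntegral.integral_eq_sub_of_hasDerivAt (fun x _ => hY x) (ic cb _ _), h0]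
    ring
  have b1 : |(1 - c) * z 0| ≤ J := by
    rw [← abs_neg, ← e1]
    refine (intervalIntegral.abs_integral_le_integral_abs (by norm_num)).trans ?_
    exact intervalIntegral.integral_mono_on (by norm_num) (ic (by fun_prop) _ _)
      (ic (by fun_prop) _ _) (fun x _ => abs_add_le _ _)
  have b2 : |Y x + c * z 0| ≤ J := by
    rw [← e2]
    refine (intervalIntegral.abs_integral_le_integral_abs hx.1).trans ?_
    refine (intervalIntegral.integral_mono_on (g := fun x => |a x| + |b x|) hx.1
      (ic (by fun_prop) _ _) (ic (by fun_prop) _ _) (fun t _ => ?_)).trans ?_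
    · have := abs_nonneg (a t); linarith
    · exact intervalIntegral.integral_mono_interval le_rfl hx.1 hx.2
        (Filter.Eventually.of_forall fun t => by simp only [Pi.zero_apply]; positivity)
        (ic (by fun_prop) _ _)
  have J0 : 0 ≤ J := (abs_nonneg _).trans b1
  have b3 : |(1 - c) * Y x| ≤ 2 * J := by
    have : (1 - c) * Y x = (1 - c) * (Y x + c * z 0) - c * ((1 - c) * z 0) := by ring
    rw [this]
    refine (abs_sub _ _).trans ?_
    rw [abs_mul (1 - c) (Y x + _), abs_mul c ((1 - c) * _), abs_of_pos hc, abs_of_pos hc0]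
    have := abs_nonneg (Y x + c * z 0)
    have := abs_nonneg ((1 - c) * z 0)
    nlinarith
  have b4 : J ^ 2 ≤ 2 * ∫ x in (0:ℝ)..1, (a x ^ 2 + b x ^ 2) := by
    refine (oe_cs _ (by fun_prop)).trans ?_
    rw [← intervalIntegral.integral_const_mul]
    refine intervalIntegral.integral_mono_on (by norm_num) (ic (by fun_prop) _ _)
      (ic (by fun_prop) _ _) (fun x _ => ?_)
    nlinarith [sq_abs (a x), sq_abs (b x), sq_nonneg (|a x| - |b x|)]
  have b5 : ((1 - c) * Y x) ^ 2 ≤ (2 * J) ^ 2 := by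
    rw [← sq_abs]; gcongr
  rw [div_mul_eq_mul_div, le_div_iff₀ (by positivity)]
  nlinarith

theorem coupled_observer_error_exponential_decay (c₂ : ℝ) (hc₂ : c₂ ∈ Ioo (0:ℝ) 1) :
    ∃ M₂ ≥ (1:ℝ), ∃ μ₂ > (0:ℝ), ∀ ztil Ytil : ℝ → ℝ → ℝ,
      ContDiff ℝ 2 (Function.uncurry ztil) →
      ContDiff ℝ 1 (Function.uncurry Ytil) →
      (∀ x ∈ Ioo (0:ℝ) 1, ∀ s ∈ Ioi (0:ℝ),
        deriv (deriv (ztil x)) s = deriv (deriv (fun y => ztil y s)) x) →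
      (∀ s ∈ Ici (0:ℝ), deriv (fun y => ztil y s) 0 = 0) →
      (∀ s ∈ Ici (0:ℝ), ztil 1 s = -Ytil 1 s) →
      (∀ x ∈ Ioo (0:ℝ) 1, ∀ s ∈ Ioi (0:ℝ),
        deriv (Ytil x) s = -deriv (fun y => Ytil y s) x) →
      (∀ s ∈ Ici (0:ℝ), Ytil 0 s = -c₂ * ztil 0 s) →
      ∀ s ∈ Ici (0:ℝ),
        observerErrorNorm ztil Ytil s
          ≤ M₂ * Real.exp (-μ₂ * s) * observerErrorNorm ztil Ytil 0 := by
  obtain ⟨hc0, hc1⟩ := hc₂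
  obtain ⟨M, hM, μ, hμ, hdec⟩ := oe_decay ((2 * c₂ - 1) ^ 2) 9 (by nlinarith) (by norm_num)
  set K : ℝ := 1 + 8 / (1 - c₂) ^ 2 with hK
  have hK1 : 1 ≤ K := by rw [hK]; have : 0 ≤ 8 / (1 - c₂) ^ 2 := by positivity
                         linarith
  refine ⟨Real.sqrt (2 * K * M), ?_, μ, hμ, ?_⟩
  · rw [ge_iff_le, Real.one_le_sqrt]; nlinarith
  intro z Y hz hY pde bz0 bz1 tr bY
  have dz : Differentiable ℝ (uncurry z) := hz.differentiable (by simp)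
  have dY : Differentiable ℝ (uncurry Y) := hY.differentiable (by simp)
  have czx : ContDiff ℝ 1 (uncurry (fun x s => deriv (fun y => z y s) x)) :=
    oe_cd_x z 1 (by simpa [one_add_one_eq_two] using hz)
  have czs : ContDiff ℝ 1 (uncurry (fun x s => deriv (z x) s)) :=
    oe_cd_s z 1 (by simpa [one_add_one_eq_two] using hz)
  have cYx : Continuous (uncurry (fun x s => deriv (fun y => Y y s) x)) :=
    (oe_cd_x Y 0 (by simpa using hY)).continuous
  have cYs : Continuous (uncurry (fun x s => deriv (Y x) s)) :=
    (oe_cd_s Y 0 (by simpa using hY)).continuous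
  have tr' : ∀ x ∈ Icc (0:ℝ) 1, ∀ s ∈ Ici (0:ℝ),
      deriv (Y x) s + deriv (fun y => Y y s) x = 0 := by
    refine oe_closure (fun x s => deriv (Y x) s + deriv (fun y => Y y s) x) (cYs.add cYx) ?_
    intro x hx s hs
    rw [tr x hx s hs]; ring
  have dzs (x s : ℝ) : DifferentiableAt ℝ (z x) s := (oe_ds z dz x s).differentiableAt
  have dzx (x s : ℝ) : DifferentiableAt ℝ (fun y => z y s) x := (oe_dx z dz x s).differentiableAt
  have dYs (x s : ℝ) : DifferentiableAt ℝ (Y x) s := (oe_ds Y dY x s).differentiableAt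
  have dYx (x s : ℝ) : DifferentiableAt ℝ (fun y => Y y s) x := (oe_dx Y dY x s).differentiableAt
  set zx : ℝ → ℝ → ℝ := fun x s => deriv (fun y => z y s) x with hzx
  set zs : ℝ → ℝ → ℝ := fun x s => deriv (z x) s with hzs
  set u : ℝ → ℝ → ℝ := fun x s => deriv (Y x) s with hu
  have dzx1 : Differentiable ℝ (uncurry zx) := czx.differentiable (by simp)
  have dzs1 : Differentiable ℝ (uncurry zs) := czs.differentiable (by simp)
  set p : ℝ → ℝ → ℝ := fun x s => zs x s + zx x s with hp
  set q : ℝ → ℝ → ℝ := fun x s => zs x s - zx x s with hq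
  have dp : Differentiable ℝ (uncurry p) := dzs1.add dzx1
  have dq : Differentiable ℝ (uncurry q) := dzs1.sub dzx1
  have a1 (x s : ℝ) : DifferentiableAt ℝ (zs x) s := (oe_ds zs dzs1 x s).differentiableAt
  have a2 (x s : ℝ) : DifferentiableAt ℝ (zx x) s := (oe_ds zx dzx1 x s).differentiableAt
  have a3 (x s : ℝ) : DifferentiableAt ℝ (fun y => zs y s) x :=
    (oe_dx zs dzs1 x s).differentiableAt
  have a4 (x s : ℝ) : DifferentiableAt ℝ (fun y => zx y s) x :=
    (oe_dx zx dzx1 x s).differentiableAt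
  have mixed (x s : ℝ) : deriv (zx x) s = deriv (fun y => zs y s) x := oe_mixed z hz x s
  have pde' : ∀ x ∈ Ioo (0:ℝ) 1, ∀ s ∈ Ioi (0:ℝ), deriv (zs x) s = deriv (fun y => zx y s) x :=
    pde
  have tp : ∀ x h s, 0 ≤ x → 0 ≤ h → x + h ≤ 1 → 0 ≤ s → p x (s + h) = p (x + h) s := by
    intro x h s hx hh hxh hs
    have := oe_transport p dp (-1) (x + h) s h hh (fun t ht => by
      have hX : x + h + -1 * t ∈ Ioo (0:ℝ) 1 := ⟨by linarith [ht.1, ht.2], by linarith [ht.1, ht.2]⟩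
      have hS : s + t ∈ Ioi (0:ℝ) := by have := ht.1; simp only [mem_Ioi]; linarith
      have e1 : deriv (p (x + h + -1 * t)) (s + t) = _ := deriv_add (a1 _ _) (a2 _ _)
      have e2 : deriv (fun y => p y (s + t)) (x + h + -1 * t) = _ := deriv_add (a3 _ _) (a4 _ _)
      rw [e1, e2, mixed, pde' _ hX _ hS]; ring)
    rwa [show x + h + -1 * h = x by ring] at this
  have tq : ∀ x h s, 0 ≤ x → 0 ≤ h → x + h ≤ 1 → 0 ≤ s → q (x + h) (s + h) = q x s := by
    intro x h s hx hh hxh hs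
    have := oe_transport q dq 1 x s h hh (fun t ht => by
      have hX : x + 1 * t ∈ Ioo (0:ℝ) 1 := ⟨by linarith [ht.1, ht.2], by linarith [ht.1, ht.2]⟩
      have hS : s + t ∈ Ioi (0:ℝ) := by have := ht.1; simp only [mem_Ioi]; linarith
      have e1 : deriv (q (x + 1 * t)) (s + t) = _ := deriv_sub (a1 _ _) (a2 _ _)
      have e2 : deriv (fun y => q y (s + t)) (x + 1 * t) = _ := deriv_sub (a3 _ _) (a4 _ _)
      rw [e1, e2, mixed, pde' _ hX _ hS]; ring)
    rwa [one_mul] at this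
  have tY : ∀ x h s, 0 ≤ x → 0 ≤ h → x + h ≤ 1 → 0 ≤ s → Y (x + h) (s + h) = Y x s := by
    intro x h s hx hh hxh hs
    have := oe_transport Y dY 1 x s h hh (fun t ht => by
      have hX : x + 1 * t ∈ Icc (0:ℝ) 1 := ⟨by linarith [ht.1, ht.2], by linarith [ht.1, ht.2]⟩
      have hS : s + t ∈ Ici (0:ℝ) := by have := ht.1; simp only [mem_Ici]; linarith
      have := tr' _ hX _ hS
      simpa using this)
    rwa [one_mul] at this
  have tu : ∀ x h s, 0 ≤ x → 0 ≤ h → x + h ≤ 1 → 0 ≤ s → u (x + h) (s + h) = u x s := by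
    intro x h s hx hh hxh hs
    have := oe_deriv_eq (fun t => Y (x + h) (t + h)) (Y x) 0 s hs
      (differentiableAt_comp_add_const.mpr (dYs (x + h) (s + h))) (dYs x s) (fun t ht => tY x h t hx hh hxh ht)
    rwa [deriv_comp_add_const] at this
  have bq : ∀ s, 0 ≤ s → q 0 s = p 0 s := by
    intro s hs
    have : zx 0 s = 0 := bz0 s hs
    simp only [hp, hq]
    rw [this]; ring
  have bu : ∀ s, 0 ≤ s → u 0 s = -c₂ * p 0 s := by
    intro s hs
    have h0 : zx 0 s = 0 := bz0 s hs
    have := oe_deriv_eq (Y 0) (fun t => -c₂ * z 0 t) 0 s hs (dYs 0 s) ((dzs 0 s).const_mul _)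
      (fun t ht => bY t ht)
    rw [deriv_const_mul _ (dzs 0 s)] at this
    simp only [hp]
    rw [h0, add_zero]; exact this
  have bp : ∀ s, 0 ≤ s → p 1 s = -2 * u 1 s - q 1 s := by
    intro s hs
    have := oe_deriv_eq (z 1) (fun t => -Y 1 t) 0 s hs (dzs 1 s) (dYs 1 s).neg
      (fun t ht => bz1 t ht)
    rw [deriv.fun_neg] at this
    have h2 : zs 1 s = - u 1 s := this
    simp only [hp, hq]
    rw [h2]; ring
  have sec {f : ℝ → ℝ → ℝ} (hf : Continuous (uncurry f)) (s : ℝ) : Continuous (fun x => f x s) :=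
    hf.comp (continuous_id.prodMk continuous_const)
  have cp := sec dp.continuous
  have cq := sec dq.continuous
  have cu := sec cYs
  have cX := sec czx.continuous
  have cS := sec czs.continuous
  have cW := sec cYx
  have cY (s : ℝ) : Continuous (fun x => Y x s) := sec dY.continuous s
  have ic {f : ℝ → ℝ} (hf : Continuous f) :
      IntervalIntegrable f MeasureTheory.volume 0 1 := hf.intervalIntegrable _ _
  set E : ℝ → ℝ := fun s => ∫ x in (0:ℝ)..1, (p x s ^ 2 + q x s ^ 2 + u x s ^ 2) with hE
  have hEn : ∀ s, 0 ≤ E s := fun s =>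
    intervalIntegral.integral_nonneg (by norm_num) (fun x _ => by positivity)
  have hfin := hdec E hEn
    (oe_step c₂ hc0 hc1 p q u cp cq cu tp tq tu bq bu bp)
    (oe_contr c₂ p q u tp tq tu bq bu bp)
  set I : ℝ → ℝ := fun s => ∫ x in (0:ℝ)..1,
    (zx x s ^ 2 + zs x s ^ 2 + Y x s ^ 2 + deriv (fun y => Y y s) x ^ 2) with hI
  have hW : ∀ x ∈ Icc (0:ℝ) 1, ∀ s, 0 ≤ s → deriv (fun y => Y y s) x ^ 2 = u x s ^ 2 := by
    intro x hx s hs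
    have h3 : u x s + deriv (fun y => Y y s) x = 0 := tr' x hx s hs
    have h4 : deriv (fun y => Y y s) x = - u x s := by linarith
    rw [h4]; ring
  have EI : ∀ s, 0 ≤ s → E s ≤ 2 * I s := by
    intro s hs
    have c1 := cp s
    have c2 := cq s
    have c3 := cu s
    have c4 := cX s
    have c5 := cS s
    have c6 := cW s
    have c7 := cY s
    simp only [hE, hI]
    rw [← intervalIntegral.integral_const_mul]
    refine intervalIntegral.integral_mono_on (by norm_num) (ic (by fun_prop)) (ic (by fun_prop)) ?_
    intro x hx
    rw [hW x hx s hs]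
    simp only [hp, hq]
    nlinarith [sq_nonneg (u x s), sq_nonneg (Y x s)]
  have IE : ∀ s, 0 ≤ s → I s ≤ K * E s := by
    intro s hs
    have c1 := cp s
    have c2 := cq s
    have c3 := cu s
    have c4 := cX s
    have c5 := cS s
    have c6 := cW s
    have c7 := cY s
    have hle : ∫ x in (0:ℝ)..1, (zx x s ^ 2 + deriv (fun y => Y y s) x ^ 2) ≤ E s := by
      refine intervalIntegral.integral_mono_on (by norm_num) (ic (by fun_prop))
        (ic (by fun_prop)) ?_
      intro x hx
      rw [hW x hx s hs]
      simp only [hp, hq]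
      nlinarith [sq_nonneg (zs x s), sq_nonneg (zx x s)]
    have hlow : ∀ x ∈ Icc (0:ℝ) 1, Y x s ^ 2 ≤ 8 / (1 - c₂) ^ 2 * E s := by
      intro x hx
      refine (oe_lower c₂ hc0 hc1 (fun y => z y s) (fun y => Y y s) (fun y => zx y s)
        (fun x => deriv (fun y => Y y s) x) (fun x => (dzx x s).hasDerivAt)
        (fun x => (dYx x s).hasDerivAt) c4 c6 (bz1 s hs) (bY s hs) x hx).trans ?_
      gcongr
    have : I s ≤ ∫ x in (0:ℝ)..1,
        ((p x s ^ 2 + q x s ^ 2 + u x s ^ 2) + 8 / (1 - c₂) ^ 2 * E s) := by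
      refine intervalIntegral.integral_mono_on (by norm_num) (ic (by fun_prop))
        (ic (by fun_prop)) ?_
      intro x hx
      rw [hW x hx s hs]
      have := hlow x hx
      simp only [hp, hq]
      nlinarith [sq_nonneg (zs x s), sq_nonneg (zx x s)]
    rw [intervalIntegral.integral_add (ic (by fun_prop)) (by simp)] at this
    simp only [intervalIntegral.integral_const, sub_zero, one_smul] at this
    calc I s ≤ E s + 8 / (1 - c₂) ^ 2 * E s := this
      _ = K * E s := by rw [hK]; ring
  intro s hs
  have hs' : 0 ≤ s := hs
  change Real.sqrt (I s) ≤ Real.sqrt (2 * K * M) * Real.exp (-μ * s) * Real.sqrt (I 0)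
  have hexp : Real.exp (-μ * s) = Real.sqrt (Real.exp (-(2 * μ) * s)) := by
    rw [show -(2 * μ) * s = -μ * s + -μ * s by ring, Real.exp_add,
      Real.sqrt_mul_self (Real.exp_pos _).le]
  rw [hexp, ← Real.sqrt_mul (by positivity), ← Real.sqrt_mul (by positivity)]
  refine Real.sqrt_le_sqrt ?_
  calc I s ≤ K * E s := IE s hs'
    _ ≤ K * (M * Real.exp (-(2 * μ) * s) * E 0) := by gcongr; exact hfin s hs'
    _ ≤ K * (M * Real.exp (-(2 * μ) * s) * (2 * I 0)) := by gcongr; exact EI 0 le_rfl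
    _ = _ := by ring
end
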